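/- Let a, ã ∈ ℝ^d, let A be the d×d matrix with entries A_{ij} = a_j (all rows equal to aᵀ), let Ã be the d×d matrix with entries Ã_{ij} = ã_i (all columns equal to ã), and let B be a symmetric real d×d matrix. Then sup_{v ∈ K(2s)} |vᵀ(A ⊙ Ã ⊙ B)v| ≤ (max_{1≤j≤d} |a_j|)·(max_{1≤i≤d} |ã_i|) · sup_{v ∈ K(2s)} |vᵀBv|. (Lemma C.2, part (ii).) -/

import Mathlib

open Matrix

/-- The sparse quadratic-form "norm" `‖A‖ₛ = sup_{v ∈ K(2s)} |vᵀAv|`, where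
`K(2s)` is the set of vectors of Euclidean norm at most one with at most `2s`
nonzero coordinates. -/
noncomputable def sparseSup (d s : ℕ) (A : Matrix (Fin d) (Fin d) ℝ) : ℝ :=
  sSup {x : ℝ | ∃ v : Fin d → ℝ, (∑ i, v i ^ 2) ≤ 1 ∧
    (Function.support v).ncard ≤ 2 * s ∧ x = |v ⬝ᵥ A.mulVec v|}

theorem abs_dotProduct_mulVec_le_sum {d : ℕ} (B : Matrix (Fin d) (Fin d) ℝ) (v : Fin d → ℝ)
    (hv : (∑ i, v i ^ 2) ≤ 1) : |v ⬝ᵥ B.mulVec v| ≤ ∑ i, ∑ j, |B i j| := by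
  have hle : ∀ i, |v i| ≤ 1 := fun i => by
    have h := Finset.single_le_sum (f := fun i => v i ^ 2) (fun j _ => sq_nonneg (v j))
      (Finset.mem_univ i)
    exact (sq_le_one_iff_abs_le_one _).1 (h.trans hv)
  simp only [dotProduct, mulVec, Finset.mul_sum]
  refine (Finset.abs_sum_le_sum_abs _ _).trans (Finset.sum_le_sum fun i _ => ?_)
  refine (Finset.abs_sum_le_sum_abs _ _).trans (Finset.sum_le_sum fun j _ => ?_)
  rw [abs_mul, abs_mul]
  calc |v i| * (|B i j| * |v j|) ≤ 1 * (|B i j| * 1) := by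
        gcongr
        · exact hle i
        · exact hle j
    _ = |B i j| := by ring

theorem sparseSup_nonneg (d s : ℕ) (B : Matrix (Fin d) (Fin d) ℝ) : 0 ≤ sparseSup d s B := by
  refine Real.sSup_nonneg ?_
  rintro x ⟨v, -, -, rfl⟩
  exact abs_nonneg _

theorem abs_dotProduct_mulVec_le_sparseSup {d s : ℕ} (B : Matrix (Fin d) (Fin d) ℝ)
    (v : Fin d → ℝ) (hv : (∑ i, v i ^ 2) ≤ 1) (hs : (Function.support v).ncard ≤ 2 * s) :
    |v ⬝ᵥ B.mulVec v| ≤ sparseSup d s B := by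
  refine le_csSup ⟨∑ i, ∑ j, |B i j|, ?_⟩ ⟨v, hv, hs, rfl⟩
  rintro x ⟨w, hw, -, rfl⟩
  exact abs_dotProduct_mulVec_le_sum B w hw

theorem abs_dotProduct_mulVec_le_sparseSup_mul {d s : ℕ} (B : Matrix (Fin d) (Fin d) ℝ)
    (v : Fin d → ℝ) (hs : (Function.support v).ncard ≤ 2 * s) :
    |v ⬝ᵥ B.mulVec v| ≤ sparseSup d s B * ∑ i, v i ^ 2 := by
  have hnn : 0 ≤ ∑ i, v i ^ 2 := Finset.sum_nonneg fun i _ => sq_nonneg (v i)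
  rcases hnn.eq_or_lt with h0 | hpos
  · have hv : v = 0 := by
      funext i
      have := (Finset.sum_eq_zero_iff_of_nonneg (fun i _ => sq_nonneg (v i))).1 h0.symm i
        (Finset.mem_univ i)
      exact pow_eq_zero_iff two_ne_zero |>.1 this
    simp [hv]
  · set r := √(∑ i, v i ^ 2) with hr
    have hr0 : 0 < r := Real.sqrt_pos.2 hpos
    have hr2 : r ^ 2 = ∑ i, v i ^ 2 := Real.sq_sqrt hnn
    have hnorm : ∑ i, (r⁻¹ • v) i ^ 2 ≤ 1 := by
      simp only [Pi.smul_apply, smul_eq_mul, mul_pow, ← Finset.mul_sum]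
      rw [← hr2, ← mul_pow, inv_mul_cancel₀ hr0.ne', one_pow]
    have hsupp : (Function.support (r⁻¹ • v)).ncard ≤ 2 * s :=
      (Set.ncard_le_ncard (Function.support_const_smul_subset _ _) (Set.toFinite _)).trans hs
    have h := abs_dotProduct_mulVec_le_sparseSup B (r⁻¹ • v) hnorm hsupp
    have heq : v ⬝ᵥ B.mulVec v = r ^ 2 * ((r⁻¹ • v) ⬝ᵥ B.mulVec (r⁻¹ • v)) := by
      simp only [mulVec_smul, dotProduct_smul, smul_dotProduct, smul_eq_mul]
      field_simp
    rw [heq, abs_mul, abs_of_nonneg (sq_nonneg r), ← hr2, mul_comm]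
    gcongr

/-- Polarization: a symmetric bilinear form is bounded by its sparse quadratic-form norm on pairs
of vectors supported in a common sparse set. -/
theorem abs_dotProduct_mulVec_le_of_support_subset {d s : ℕ} {B : Matrix (Fin d) (Fin d) ℝ}
    (hB : B.IsSymm) {S : Set (Fin d)} (hS : S.ncard ≤ 2 * s) {u w : Fin d → ℝ}
    (hu : Function.support u ⊆ S) (hw : Function.support w ⊆ S)
    (hu1 : ∑ i, u i ^ 2 ≤ 1) (hw1 : ∑ i, w i ^ 2 ≤ 1) :
    |u ⬝ᵥ B.mulVec w| ≤ sparseSup d s B := by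
  have hadd := abs_dotProduct_mulVec_le_sparseSup_mul (s := s) B (u + w)
    ((Set.ncard_le_ncard ((Function.support_add u w).trans (Set.union_subset hu hw))
      (Set.toFinite _)).trans hS)
  have hsub := abs_dotProduct_mulVec_le_sparseSup_mul (s := s) B (u - w)
    ((Set.ncard_le_ncard ((Function.support_sub u w).trans (Set.union_subset hu hw))
      (Set.toFinite _)).trans hS)
  have hcomm : w ⬝ᵥ B.mulVec u = u ⬝ᵥ B.mulVec w := by
    rw [dotProduct_mulVec, ← mulVec_transpose, hB.eq, dotProduct_comm]
  have hsum : ∑ i, (u + w) i ^ 2 + ∑ i, (u - w) i ^ 2 = 2 * (∑ i, u i ^ 2 + ∑ i, w i ^ 2) := by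
    simp only [Pi.add_apply, Pi.sub_apply, ← Finset.sum_add_distrib, Finset.mul_sum]
    exact Finset.sum_congr rfl fun i _ => by ring
  have hpol : 4 * (u ⬝ᵥ B.mulVec w)
      = (u + w) ⬝ᵥ B.mulVec (u + w) - (u - w) ⬝ᵥ B.mulVec (u - w) := by
    simp only [mulVec_add, mulVec_sub, dotProduct_add, dotProduct_sub, add_dotProduct,
      sub_dotProduct, hcomm]
    ring
  have hbound : sparseSup d s B * (∑ i, (u + w) i ^ 2 + ∑ i, (u - w) i ^ 2)
      ≤ sparseSup d s B * 4 :=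
    mul_le_mul_of_nonneg_left (by linarith) (sparseSup_nonneg d s B)
  rw [mul_add] at hbound
  rw [abs_le] at hadd hsub ⊢
  constructor <;> linarith [hadd.1, hadd.2, hsub.1, hsub.2]

theorem sum_div_iSup_mul_sq_le {d : ℕ} (a v : Fin d → ℝ) :
    ∑ i, (a i / (⨆ j, |a j|) * v i) ^ 2 ≤ ∑ i, v i ^ 2 := by
  refine Finset.sum_le_sum fun i _ => ?_
  have hle : |a i| ≤ ⨆ j, |a j| := le_ciSup (Set.finite_range fun j => |a j|).bddAbove i
  have h1 : |a i / (⨆ j, |a j|)| ≤ 1 := by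
    rw [abs_div, abs_of_nonneg ((abs_nonneg _).trans hle)]
    exact div_le_one_of_le₀ hle ((abs_nonneg _).trans hle)
  rw [mul_pow]
  exact mul_le_of_le_one_left (sq_nonneg _) ((sq_le_one_iff_abs_le_one _).2 h1)

theorem iSup_abs_mul_div_cancel {d : ℕ} (a : Fin d → ℝ) (i : Fin d) :
    (⨆ j, |a j|) * (a i / ⨆ j, |a j|) = a i := by
  have hle : |a i| ≤ ⨆ j, |a j| := le_ciSup (Set.finite_range fun j => |a j|).bddAbove i
  refine mul_div_cancel_of_imp' fun h => ?_
  rw [h] at hle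
  exact abs_nonpos_iff.1 hle

theorem stmt8 (d s : ℕ) (a a' : Fin d → ℝ) (B : Matrix (Fin d) (Fin d) ℝ)
    (hB : B.IsSymm) :
    sparseSup d s ((Matrix.of fun _ j => a j).hadamard
        ((Matrix.of fun i _ => a' i).hadamard B))
      ≤ (⨆ j, |a j|) * (⨆ i, |a' i|) * sparseSup d s B := by
  have ha : 0 ≤ ⨆ j, |a j| := Real.iSup_nonneg fun j => abs_nonneg _
  have ha' : 0 ≤ ⨆ i, |a' i| := Real.iSup_nonneg fun i => abs_nonneg _
  refine Real.sSup_le ?_ (mul_nonneg (mul_nonneg ha ha') (sparseSup_nonneg d s B))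
  rintro x ⟨v, hv, hs, rfl⟩
  set u : Fin d → ℝ := fun i => a' i / (⨆ j, |a' j|) * v i with hu
  set w : Fin d → ℝ := fun i => a i / (⨆ j, |a j|) * v i with hw
  have key : |u ⬝ᵥ B.mulVec w| ≤ sparseSup d s B :=
    abs_dotProduct_mulVec_le_of_support_subset hB hs
      (Function.support_mul_subset_right _ _) (Function.support_mul_subset_right _ _)
      ((sum_div_iSup_mul_sq_le a' v).trans hv) ((sum_div_iSup_mul_sq_le a v).trans hv)
  have heq : v ⬝ᵥ ((Matrix.of fun _ j => a j).hadamard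
      ((Matrix.of fun i _ => a' i).hadamard B)).mulVec v
      = (⨆ j, |a j|) * (⨆ i, |a' i|) * (u ⬝ᵥ B.mulVec w) := by
    simp only [dotProduct, mulVec, Finset.mul_sum, hadamard_apply, of_apply]
    refine Finset.sum_congr rfl fun i _ => Finset.sum_congr rfl fun j _ => ?_
    conv_lhs => rw [← iSup_abs_mul_div_cancel a j, ← iSup_abs_mul_div_cancel a' i]
    ring
  rw [heq, abs_mul, abs_of_nonneg (mul_nonneg ha ha')]
  exact mul_le_mul_of_nonneg_left key (mul_nonneg ha ha')
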